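/- arXiv:2412.20609 — 2 statements merged into one kernel-verified Lean document; each statement's English description precedes it below -/
import Mathlib

section
/- Let R be either L or H and let S be a reduced proper subset of R. (1) If R = L and 16 divides Γ(S), then S is not a ringset of L. (2) If R = H and 4 divides Γ(S), then S is not a ringset of H. (Here Γ(S) = 0 when S is a singleton, so singleton reduced sets are covered by both parts.) -/
noncomputable section

open Polynomial

abbrev 𝔻 : Type := Quaternion ℚ

def qi : 𝔻 := QuaternionAlgebra.mk 0 1 0 0
def qj : 𝔻 := QuaternionAlgebra.mk 0 0 1 0
def qk : 𝔻 := QuaternionAlgebra.mk 0 0 0 1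

def isIntQ (q : ℚ) : Prop := ∃ z : ℤ, q = (z : ℚ)
def isHalfOddQ (q : ℚ) : Prop := ∃ z : ℤ, q = (z : ℚ) + 1/2

def Lip : Set 𝔻 :=
  {α | isIntQ α.re ∧ isIntQ α.imI ∧ isIntQ α.imJ ∧ isIntQ α.imK}

def HurOff : Set 𝔻 :=
  {α | isHalfOddQ α.re ∧ isHalfOddQ α.imI ∧ isHalfOddQ α.imJ ∧ isHalfOddQ α.imK}

def Hur : Set 𝔻 := Lip ∪ HurOff

def qnorm (α : 𝔻) : ℚ := α.re ^ 2 + α.imI ^ 2 + α.imJ ^ 2 + α.imK ^ 2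

def minPoly (α : 𝔻) : Polynomial ℚ :=
  if α.imI = 0 ∧ α.imJ = 0 ∧ α.imK = 0 then X - C α.re
  else X ^ 2 - C (2 * α.re) * X + C (qnorm α)

def classOf (R : Set 𝔻) (m : Polynomial ℤ) : Set 𝔻 :=
  {α | α ∈ R ∧ minPoly α = m.map (Int.castRingHom ℚ)}

def IntPolys (S R : Set 𝔻) : Set (Polynomial 𝔻) :=
  {f | ∀ α ∈ S, f.eval α ∈ R}

def IsRingset (S R : Set 𝔻) : Prop :=
  ∀ f ∈ IntPolys S R, ∀ g ∈ IntPolys S R, f * g ∈ IntPolys S R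

def transSet (S : Set 𝔻) (a : ℤ) : Set 𝔻 := (fun α => α + (a : 𝔻)) '' S

def scaleSet (n : ℤ) (R : Set 𝔻) : Set 𝔻 := (fun α => (n : 𝔻) * α) '' R

def IsReducedIn (S R : Set 𝔻) : Prop :=
  (∃ m : Polynomial ℤ, m.Monic ∧ m.natDegree = 2 ∧ S ⊆ classOf R m) ∧
  (∀ a n : ℤ, 2 ≤ n → ¬ (transSet S a ⊆ scaleSet n R))

def diffs (S : Set 𝔻) : Set 𝔻 := {δ | ∃ α ∈ S, ∃ β ∈ S, δ = α - β}

def normsOf (S : Set 𝔻) : Set ℤ := {n : ℤ | ∃ δ ∈ diffs S, (n : ℚ) = qnorm δ}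

def gam (S : Set 𝔻) : ℕ := sSup {g : ℕ | ∀ t ∈ normsOf S, (g : ℤ) ∣ t}

def starSet (S R : Set 𝔻) : Set 𝔻 :=
  {β | ∃ α ∈ S, ∃ u v : 𝔻, u ∈ R ∧ v ∈ R ∧ u * v = 1 ∧ v * u = 1 ∧ β = u * α * v}

def idealGen (R : Set 𝔻) (x : 𝔻) : Set 𝔻 :=
  {β | ∃ n : ℕ, ∃ a b : Fin n → 𝔻, (∀ k, a k ∈ R) ∧ (∀ k, b k ∈ R) ∧ β = ∑ k, a k * x * b k}

/-- The quaternion with the given coordinates. -/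
def quat (a b c d : ℚ) : 𝔻 := ⟨a, b, c, d⟩

@[simp] theorem quat_re (a b c d : ℚ) : (quat a b c d).re = a := rfl
@[simp] theorem quat_imI (a b c d : ℚ) : (quat a b c d).imI = b := rfl
@[simp] theorem quat_imJ (a b c d : ℚ) : (quat a b c d).imJ = c := rfl
@[simp] theorem quat_imK (a b c d : ℚ) : (quat a b c d).imK = d := rfl

theorem quat_inj {a b c d a' b' c' d' : ℚ} :
    quat a b c d = quat a' b' c' d' ↔ a = a' ∧ b = b' ∧ c = c' ∧ d = d' :=
  QuaternionAlgebra.mk.injEq .. ▸ Iff.rfl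

theorem qi_eq : qi = quat 0 1 0 0 := rfl
theorem qj_eq : qj = quat 0 0 1 0 := rfl

/-- A polynomial `d (x - α)` in `Int(S, R)` and a constant `b ∈ R` witness that `S` is not a ringset
as soon as `d (b α - α b) ∉ R`. -/
theorem not_isRingset_of_commutator {S R : Set 𝔻} {α d b : 𝔻} (hα : α ∈ S)
    (hd : ∀ β ∈ S, d * (β - α) ∈ R) (hb : b ∈ R) (h : d * (b * α - α * b) ∉ R) :
    ¬ IsRingset S R := by
  intro hS
  have hf : C d * X - C (d * α) ∈ IntPolys S R := fun β hβ => by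
    simpa [mul_sub] using hd β hβ
  have hg : C b ∈ IntPolys S R := fun β _ => by simpa using hb
  have hfg : (C d * X - C (d * α)) * C b = C (d * b) * X - C (d * α * b) := by
    rw [sub_mul, mul_assoc, X_mul_C, ← mul_assoc, ← C_mul, ← C_mul]
  have := hS _ hf _ hg α hα
  rw [hfg] at this
  apply h
  simpa [mul_sub, mul_assoc] using this

theorem gam_dvd {S : Set 𝔻} {t : ℤ} (ht : t ∈ normsOf S) : (gam S : ℤ) ∣ t := by
  rcases eq_or_ne t 0 with rfl | h0
  · exact dvd_zero _
  have hmem : gam S ∈ {g : ℕ | ∀ t ∈ normsOf S, (g : ℤ) ∣ t} := by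
    refine Nat.sSup_mem ⟨1, fun t _ => by simp⟩ ⟨t.natAbs, fun g hg => ?_⟩
    exact Nat.le_of_dvd (Int.natAbs_pos.mpr h0) (Int.natCast_dvd.mp (hg t ht))
  exact hmem t ht

theorem dvd_of_dvd_gam {S : Set 𝔻} {n : ℕ} (hn : n ∣ gam S) {α β : 𝔻} (hα : α ∈ S) (hβ : β ∈ S)
    {t : ℤ} (ht : (t : ℚ) = qnorm (α - β)) : (n : ℤ) ∣ t :=
  (Int.natCast_dvd_natCast.mpr hn).trans (gam_dvd ⟨_, ⟨α, hα, β, hβ, rfl⟩, ht⟩)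

/-- A reduced set has no integer translate contained in `2R`. -/
theorem IsReducedIn.exists_half_notMem {S R : Set 𝔻} (h : IsReducedIn S R) (a : ℤ) :
    ∃ α ∈ S, quat (1 / 2) 0 0 0 * (α + a) ∉ R := by
  by_contra! hall
  refine h.2 a 2 le_rfl ?_
  rintro _ ⟨α, hα, rfl⟩
  refine ⟨_, hall α hα, ?_⟩
  have htwo : ((2 : ℤ) : 𝔻) * quat (1 / 2) 0 0 0 = 1 := by
    rw [Int.cast_ofNat, two_mul]
    ext <;> simp <;> norm_num <;> rfl
  simp only [← mul_assoc, htwo, one_mul]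

theorem exists_mem_of_isReducedIn {S R : Set 𝔻} (h : IsReducedIn S R) : ∃ α, α ∈ S :=
  let ⟨α, hα, _⟩ := h.exists_half_notMem 0
  ⟨α, hα⟩

theorem Int.emod_two_eq_of_four_dvd_sum_sq {a b c d : ℤ} (h : 4 ∣ a ^ 2 + b ^ 2 + c ^ 2 + d ^ 2) :
    a % 2 = b % 2 ∧ a % 2 = c % 2 ∧ a % 2 = d % 2 := by
  have key : ∀ x : ℤ, (x % 2 = 0 ∧ x ^ 2 % 4 = 0) ∨ (x % 2 = 1 ∧ x ^ 2 % 4 = 1) := fun x => by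
    rcases Int.even_or_odd' x with ⟨y, rfl | rfl⟩
    · left; ring_nf; omega
    · right; ring_nf; omega
  have := key a
  have := key b
  have := key c
  have := key d
  omega

theorem Int.four_dvd_sum_sq_of_emod_two_eq {a b c d : ℤ} (hb : a % 2 = b % 2)
    (hc : a % 2 = c % 2) (hd : a % 2 = d % 2) : 4 ∣ a ^ 2 + b ^ 2 + c ^ 2 + d ^ 2 := by
  obtain ⟨p, rfl⟩ : ∃ p, b = a + 2 * p := ⟨(b - a) / 2, by omega⟩
  obtain ⟨q, rfl⟩ : ∃ q, c = a + 2 * q := ⟨(c - a) / 2, by omega⟩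
  obtain ⟨r, rfl⟩ : ∃ r, d = a + 2 * r := ⟨(d - a) / 2, by omega⟩
  exact ⟨a ^ 2 + a * (p + q + r) + p ^ 2 + q ^ 2 + r ^ 2, by ring⟩

theorem Int.two_dvd_of_sixteen_dvd_sum_sq {a b c d : ℤ}
    (h : 16 ∣ a ^ 2 + b ^ 2 + c ^ 2 + d ^ 2) : 2 ∣ a ∧ 2 ∣ b ∧ 2 ∣ c ∧ 2 ∣ d := by
  obtain ⟨hb, hc, hd⟩ := Int.emod_two_eq_of_four_dvd_sum_sq ((by norm_num : (4 : ℤ) ∣ 16).trans h)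
  have key : ∀ x : ℤ, x % 2 = 1 → x ^ 2 % 8 = 1 := fun x hx => by
    have := Int.eight_dvd_sq_sub_one_of_odd (Int.odd_iff.mpr hx)
    omega
  have ha : a % 2 = 0 := by
    by_contra h0
    have := key a (by omega)
    have := key b (by omega)
    have := key c (by omega)
    have := key d (by omega)
    omega
  omega

/-- If `16` divides a sum of four squares, the four numbers are twice numbers of equal parity. -/
theorem Int.exists_halves_of_sixteen_dvd_sum_sq {a b c d : ℤ}
    (h : 16 ∣ a ^ 2 + b ^ 2 + c ^ 2 + d ^ 2) :
    ∃ a' b' c' d' : ℤ, a = 2 * a' ∧ b = 2 * b' ∧ c = 2 * c' ∧ d = 2 * d' ∧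
      a' % 2 = b' % 2 ∧ a' % 2 = c' % 2 ∧ a' % 2 = d' % 2 := by
  obtain ⟨⟨a', rfl⟩, ⟨b', rfl⟩, ⟨c', rfl⟩, ⟨d', rfl⟩⟩ := Int.two_dvd_of_sixteen_dvd_sum_sq h
  refine ⟨a', b', c', d', rfl, rfl, rfl, rfl, Int.emod_two_eq_of_four_dvd_sum_sq ?_⟩
  ring_nf at h ⊢
  omega

theorem mem_Lip_iff {α : 𝔻} : α ∈ Lip ↔ ∃ a b c d : ℤ, α = quat a b c d := by
  constructor
  · rintro ⟨⟨a, ha⟩, ⟨b, hb⟩, ⟨c, hc⟩, ⟨d, hd⟩⟩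
    exact ⟨a, b, c, d, by ext <;> assumption⟩
  · rintro ⟨a, b, c, d, rfl⟩
    exact ⟨⟨a, rfl⟩, ⟨b, rfl⟩, ⟨c, rfl⟩, ⟨d, rfl⟩⟩

/-- Hurwitz quaternions are the halves of integral quaternions with coordinates of equal parity. -/
theorem mem_Hur_iff {α : 𝔻} : α ∈ Hur ↔ ∃ a b c d : ℤ, α = quat (a / 2) (b / 2) (c / 2) (d / 2) ∧
    a % 2 = b % 2 ∧ a % 2 = c % 2 ∧ a % 2 = d % 2 := by
  constructor
  · rintro (⟨⟨a, ha⟩, ⟨b, hb⟩, ⟨c, hc⟩, ⟨d, hd⟩⟩ | ⟨⟨a, ha⟩, ⟨b, hb⟩, ⟨c, hc⟩, ⟨d, hd⟩⟩)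
    · refine ⟨2 * a, 2 * b, 2 * c, 2 * d, ?_, by omega⟩
      ext <;> simp [*]
    · refine ⟨2 * a + 1, 2 * b + 1, 2 * c + 1, 2 * d + 1, ?_, by omega⟩
      ext <;> simp [*] <;> ring
  · rintro ⟨a, b, c, d, rfl, h⟩
    rcases Int.emod_two_eq_zero_or_one a with ha | ha
    · have half : ∀ x : ℤ, x % 2 = 0 → isIntQ (x / 2) := fun x hx => by
        obtain ⟨y, rfl⟩ := Int.dvd_of_emod_eq_zero hx
        exact ⟨y, by push_cast; ring⟩
      exact Or.inl ⟨half a ha, half b (by omega), half c (by omega), half d (by omega)⟩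
    · have half : ∀ x : ℤ, x % 2 = 1 → isHalfOddQ (x / 2) := fun x hx => by
        obtain ⟨y, rfl⟩ := Int.odd_iff.mpr hx
        exact ⟨y, by push_cast; ring⟩
      exact Or.inr ⟨half a ha, half b (by omega), half c (by omega), half d (by omega)⟩

theorem half_mem_Hur_iff {a b c d : ℤ} : quat (a / 2) (b / 2) (c / 2) (d / 2) ∈ Hur ↔
    a % 2 = b % 2 ∧ a % 2 = c % 2 ∧ a % 2 = d % 2 := by
  refine ⟨fun h => ?_, fun h => mem_Hur_iff.mpr ⟨a, b, c, d, rfl, h⟩⟩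
  obtain ⟨a', b', c', d', h, hp⟩ := mem_Hur_iff.mp h
  simp only [quat_inj, div_left_inj' (two_ne_zero' ℚ), Int.cast_inj] at h
  omega

theorem half_mem_Lip_iff {a b c d : ℤ} : quat (a / 2) (b / 2) (c / 2) (d / 2) ∈ Lip ↔
    2 ∣ a ∧ 2 ∣ b ∧ 2 ∣ c ∧ 2 ∣ d := by
  have key : ∀ x : ℤ, isIntQ (x / 2) ↔ 2 ∣ x := fun x => by
    constructor
    · rintro ⟨y, hy⟩
      exact ⟨y, by have : (x : ℚ) = 2 * y := by linarith
                   exact_mod_cast this⟩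
    · rintro ⟨y, rfl⟩
      exact ⟨y, by push_cast; ring⟩
  exact and_congr (key a) (and_congr (key b) (and_congr (key c) (key d)))

theorem not_isRingset_Lip {S : Set 𝔻} (hsub : S ⊆ Lip) (hred : IsReducedIn S Lip)
    (hg : 16 ∣ gam S) : ¬ IsRingset S Lip := by
  obtain ⟨α, hα⟩ := exists_mem_of_isReducedIn hred
  obtain ⟨a, b, c, d, rfl⟩ := mem_Lip_iff.mp (hsub hα)
  have hdiff : ∀ β ∈ S, ∃ p q r s : ℤ,
      β = quat (a + 2 * p) (b + 2 * q) (c + 2 * r) (d + 2 * s) ∧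
      p % 2 = q % 2 ∧ p % 2 = r % 2 ∧ p % 2 = s % 2 := fun β hβ => by
    obtain ⟨a', b', c', d', rfl⟩ := mem_Lip_iff.mp (hsub hβ)
    have h16 := dvd_of_dvd_gam hg hβ hα
      (t := (a' - a) ^ 2 + (b' - b) ^ 2 + (c' - c) ^ 2 + (d' - d) ^ 2) (by simp [qnorm])
    obtain ⟨p, q, r, s, hp, hq, hr, hs, hpar⟩ := Int.exists_halves_of_sixteen_dvd_sum_sq h16
    obtain rfl : a' = a + 2 * p := by omega
    obtain rfl : b' = b + 2 * q := by omega
    obtain rfl : c' = c + 2 * r := by omega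
    obtain rfl : d' = d + 2 * s := by omega
    exact ⟨p, q, r, s, by push_cast; rfl, hpar⟩
  have hd : ∀ β ∈ S, quat (1 / 4) (1 / 4) 0 0 * (β - quat a b c d) ∈ Lip := fun β hβ => by
    obtain ⟨p, q, r, s, rfl, hpar⟩ := hdiff β hβ
    have heq : quat (1 / 4) (1 / 4) 0 0 *
        (quat (a + 2 * p) (b + 2 * q) (c + 2 * r) (d + 2 * s) - quat a b c d) =
        quat ((p - q : ℤ) / 2) ((p + q : ℤ) / 2) ((r - s : ℤ) / 2) ((r + s : ℤ) / 2) := by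
      ext <;> simp <;> ring
    rw [heq, half_mem_Lip_iff]
    omega
  by_cases hi : 2 ∣ c - d
  · by_cases hj : 2 ∣ b ∧ 2 ∣ d
    · obtain ⟨β, hβ, hn⟩ := hred.exists_half_notMem (-a)
      obtain ⟨p, q, r, s, rfl, -⟩ := hdiff β hβ
      refine absurd ?_ hn
      have heq : quat (1 / 2) 0 0 0 *
          (quat (a + 2 * p) (b + 2 * q) (c + 2 * r) (d + 2 * s) + (-a : ℤ)) =
          quat ((2 * p : ℤ) / 2) ((b + 2 * q : ℤ) / 2) ((c + 2 * r : ℤ) / 2)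
            ((d + 2 * s : ℤ) / 2) := by
        ext <;> simp <;> ring
      rw [heq, half_mem_Lip_iff]
      omega
    · refine not_isRingset_of_commutator (b := qj) hα hd
        (mem_Lip_iff.mpr ⟨0, 0, 1, 0, by rfl⟩) ?_
      have heq : quat (1 / 4) (1 / 4) 0 0 *
          (qj * quat a b c d - quat a b c d * qj) =
          quat ((-d : ℤ) / 2) ((d : ℤ) / 2) ((b : ℤ) / 2) ((-b : ℤ) / 2) := by
        ext <;> simp [qj_eq] <;> ring
      rw [heq, half_mem_Lip_iff]
      omega
  · refine not_isRingset_of_commutator (b := qi) hα hd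
      (mem_Lip_iff.mpr ⟨0, 1, 0, 0, by simp [qi_eq]⟩) ?_
    have heq : quat (1 / 4) (1 / 4) 0 0 *
        (qi * quat a b c d - quat a b c d * qi) =
        quat ((0 : ℤ) / 2) ((0 : ℤ) / 2) ((-(c + d) : ℤ) / 2) ((c - d : ℤ) / 2) := by
      ext <;> simp [qi_eq] <;> ring
    rw [heq, half_mem_Lip_iff]
    omega

theorem not_isRingset_Hur {S : Set 𝔻} (hsub : S ⊆ Hur) (hred : IsReducedIn S Hur)
    (hg : 4 ∣ gam S) : ¬ IsRingset S Hur := by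
  obtain ⟨α, hα⟩ := exists_mem_of_isReducedIn hred
  obtain ⟨a, b, c, d, rfl, hpar⟩ := mem_Hur_iff.mp (hsub hα)
  have hdiff : ∀ β ∈ S, ∃ p q r s : ℤ,
      β = quat (a / 2 + p) (b / 2 + q) (c / 2 + r) (d / 2 + s) ∧
      p % 2 = q % 2 ∧ p % 2 = r % 2 ∧ p % 2 = s % 2 := fun β hβ => by
    obtain ⟨a', b', c', d', rfl, hpar'⟩ := mem_Hur_iff.mp (hsub hβ)
    obtain ⟨t, ht⟩ : 4 ∣ (a' - a) ^ 2 + (b' - b) ^ 2 + (c' - c) ^ 2 + (d' - d) ^ 2 := by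
      apply Int.four_dvd_sum_sq_of_emod_two_eq <;> omega
    have h4 := dvd_of_dvd_gam hg hβ hα (t := t) (by
      have : ((a' : ℚ) - a) ^ 2 + (b' - b) ^ 2 + (c' - c) ^ 2 + (d' - d) ^ 2 = 4 * t := by
        exact_mod_cast ht
      simp [qnorm]
      linarith)
    obtain ⟨p, q, r, s, hp, hq, hr, hs, hpqrs⟩ := Int.exists_halves_of_sixteen_dvd_sum_sq
      (a := a' - a) (b := b' - b) (c := c' - c) (d := d' - d) (by omega)
    obtain rfl : a' = a + 2 * p := by omega
    obtain rfl : b' = b + 2 * q := by omega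
    obtain rfl : c' = c + 2 * r := by omega
    obtain rfl : d' = d + 2 * s := by omega
    refine ⟨p, q, r, s, ?_, hpqrs⟩
    ext <;> simp <;> ring
  have hd : ∀ β ∈ S, quat (1 / 2) 0 0 0 * (β - quat (a / 2) (b / 2) (c / 2) (d / 2)) ∈ Hur :=
    fun β hβ => by
      obtain ⟨p, q, r, s, rfl, hpqrs⟩ := hdiff β hβ
      refine mem_Hur_iff.mpr ⟨p, q, r, s, ?_, hpqrs⟩
      ext <;> simp <;> ring
  by_cases ha : 2 ∣ a
  · obtain ⟨a, rfl⟩ := ha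
    obtain ⟨b, rfl⟩ : 2 ∣ b := by omega
    obtain ⟨c, rfl⟩ : 2 ∣ c := by omega
    obtain ⟨d, rfl⟩ : 2 ∣ d := by omega
    by_cases hbcd : b % 2 = c % 2 ∧ b % 2 = d % 2
    · obtain ⟨β, hβ, hn⟩ := hred.exists_half_notMem (b - a)
      obtain ⟨p, q, r, s, rfl, hpqrs⟩ := hdiff β hβ
      refine absurd (mem_Hur_iff.mpr ⟨b + p, b + q, c + r, d + s, ?_, by omega⟩) hn
      ext <;> simp <;> ring
    · refine not_isRingset_of_commutator (b := quat (1 / 2) (1 / 2) (1 / 2) (1 / 2)) hα hd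
        (mem_Hur_iff.mpr ⟨1, 1, 1, 1, by simp, by simp⟩) ?_
      have heq : quat (1 / 2) 0 0 0 *
          (quat (1 / 2) (1 / 2) (1 / 2) (1 / 2) *
              quat ((2 * a : ℤ) / 2) ((2 * b : ℤ) / 2) ((2 * c : ℤ) / 2) ((2 * d : ℤ) / 2) -
            quat ((2 * a : ℤ) / 2) ((2 * b : ℤ) / 2) ((2 * c : ℤ) / 2) ((2 * d : ℤ) / 2) *
              quat (1 / 2) (1 / 2) (1 / 2) (1 / 2)) =
          quat ((0 : ℤ) / 2) ((d - c : ℤ) / 2) ((b - d : ℤ) / 2) ((c - b : ℤ) / 2) := by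
        ext <;> simp <;> ring
      rw [heq, half_mem_Hur_iff]
      omega
  · refine not_isRingset_of_commutator (b := qi) hα hd
      (mem_Hur_iff.mpr ⟨0, 2, 0, 0, by simp [qi_eq], by simp⟩) ?_
    have heq : quat (1 / 2) 0 0 0 *
        (qi * quat (a / 2) (b / 2) (c / 2) (d / 2) -
          quat (a / 2) (b / 2) (c / 2) (d / 2) * qi) =
        quat ((0 : ℤ) / 2) ((0 : ℤ) / 2) ((-d : ℤ) / 2) ((c : ℤ) / 2) := by
      ext <;> simp [qi_eq] <;> ring
    rw [heq, half_mem_Hur_iff]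
    omega

/-- Reduced sets with Γ(S) divisible by 16 (over L) or by 4 (over H) are not ringsets. -/
theorem stmt_14 (R : Set 𝔻) (hR : R = Lip ∨ R = Hur)
    (S : Set 𝔻) (hsub : S ⊂ R) (hred : IsReducedIn S R) :
    (R = Lip → 16 ∣ gam S → ¬ IsRingset S Lip) ∧
    (R = Hur → 4 ∣ gam S → ¬ IsRingset S Hur) := by
  constructor
  · rintro rfl
    exact not_isRingset_Lip hsub.subset hred
  · rintro rfl
    exact not_isRingset_Hur hsub.subset hred
end
end

section
/- Let S be a reduced proper subset of the Lipschitz quaternions L. Suppose there exists r ∈ {2i+2j, 2i+2k, 2j+2k} such that every δ ∈ Δ(S) satisfies δ ∈ 4L or δ − r ∈ 4L (i.e., Δ(S) modulo 4 is contained in one of the sets {0, 2i+2j}, {0, 2i+2k}, {0, 2j+2k}). Then S is not a ringset of L. -/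
noncomputable section

open Polynomial

open scoped Quaternion

@[simp] lemma re_qi : qi.re = 0 := rfl

@[simp] lemma imI_qi : qi.imI = 1 := rfl

@[simp] lemma imJ_qi : qi.imJ = 0 := rfl

@[simp] lemma imK_qi : qi.imK = 0 := rfl

@[simp] lemma re_qj : qj.re = 0 := rfl

@[simp] lemma imI_qj : qj.imI = 0 := rfl

@[simp] lemma imJ_qj : qj.imJ = 1 := rfl

@[simp] lemma imK_qj : qj.imK = 0 := rfl

@[simp] lemma re_qk : qk.re = 0 := rfl

@[simp] lemma imI_qk : qk.imI = 0 := rfl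

@[simp] lemma imJ_qk : qk.imJ = 0 := rfl

@[simp] lemma imK_qk : qk.imK = 1 := rfl

lemma scaleSet_mem_of_coords {n : ℤ} {α : 𝔻} (x y z w : ℤ) (hx : α.re = n * x)
    (hy : α.imI = n * y) (hz : α.imJ = n * z) (hw : α.imK = n * w) :
    α ∈ scaleSet n Lip := by
  obtain ⟨β, h₁, h₂, h₃, h₄⟩ :
      ∃ β : 𝔻, β.re = x ∧ β.imI = y ∧ β.imJ = z ∧ β.imK = w :=
    ⟨⟨x, y, z, w⟩, rfl, rfl, rfl, rfl⟩
  refine ⟨β, ⟨⟨x, h₁⟩, ⟨y, h₂⟩, ⟨z, h₃⟩, ⟨w, h₄⟩⟩, ?_⟩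
  ext <;> simp [*]

lemma coords_of_mem_scaleSet {n : ℤ} {α : 𝔻} (hα : α ∈ scaleSet n Lip) :
    ∃ x y z w : ℤ, α.re = n * x ∧ α.imI = n * y ∧ α.imJ = n * z ∧ α.imK = n * w := by
  obtain ⟨β, ⟨⟨x, hx⟩, ⟨y, hy⟩, ⟨z, hz⟩, ⟨w, hw⟩⟩, rfl⟩ := hα
  exact ⟨x, y, z, w, by simp [hx], by simp [hy], by simp [hz], by simp [hw]⟩

lemma IsReducedIn.nonempty {S R : Set 𝔻} (hred : IsReducedIn S R) : S.Nonempty := by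
  by_contra hne
  rw [Set.not_nonempty_iff_eq_empty] at hne
  subst hne
  exact hred.2 0 2 le_rfl (by simp [transSet])

lemma IsRingset.mul_commutator_mem {S R : Set 𝔻} (hS : IsRingset S R) {α₀ : 𝔻} (hα₀ : α₀ ∈ S)
    {a u : 𝔻} (ha : ∀ α ∈ S, a * (α - α₀) ∈ R) (hu : u ∈ R) :
    a * (u * α₀ - α₀ * u) ∈ R := by
  have hf : C a * X - C (a * α₀) ∈ IntPolys S R := fun α hα => by
    simpa [mul_sub, eval_C_mul] using ha α hα
  have hprod := hS _ hf (C u) (fun α _ => by simpa using hu) α₀ hα₀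
  have hmul : (C a * X - C (a * α₀)) * C u = C (a * u) * X - C (a * α₀ * u) := by
    rw [sub_mul, mul_assoc, X_mul_C, ← mul_assoc, ← C_mul, ← C_mul]
  rw [hmul, eval_sub, eval_C_mul, eval_X, eval_C] at hprod
  simpa [mul_sub, mul_assoc] using hprod

lemma IsReducedIn.not_even_imaginary {S : Set 𝔻} (hred : IsReducedIn S Lip) {α₀ : 𝔻}
    (hα₀ : α₀ ∈ Lip) (hdiff : ∀ α ∈ S, α - α₀ ∈ scaleSet 2 Lip) :
    ¬ (isIntQ (α₀.imI / 2) ∧ isIntQ (α₀.imJ / 2) ∧ isIntQ (α₀.imK / 2)) := by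
  rintro ⟨⟨p, hp⟩, ⟨q, hq⟩, ⟨s, hs⟩⟩
  obtain ⟨⟨e, he⟩, -⟩ := hα₀
  refine hred.2 (-e) 2 le_rfl ?_
  rintro _ ⟨α, hα, rfl⟩
  obtain ⟨x, y, z, w, hx, hy, hz, hw⟩ := coords_of_mem_scaleSet (hdiff α hα)
  simp only [Quaternion.re_sub, Quaternion.imI_sub, Quaternion.imJ_sub,
    Quaternion.imK_sub] at hx hy hz hw
  push_cast at hx hy hz hw
  refine scaleSet_mem_of_coords x (y + p) (z + q) (w + s) ?_ ?_ ?_ ?_ <;> simp <;> linarith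

lemma mul_mem_Lip {α β : 𝔻} (hα : α ∈ Lip) (hβ : β ∈ Lip) : α * β ∈ Lip := by
  obtain ⟨⟨a, ha⟩, ⟨b, hb⟩, ⟨c, hc⟩, ⟨d, hd⟩⟩ := hα
  obtain ⟨⟨x, hx⟩, ⟨y, hy⟩, ⟨z, hz⟩, ⟨w, hw⟩⟩ := hβ
  refine ⟨⟨a * x - b * y - c * z - d * w, ?_⟩, ⟨a * y + b * x + c * w - d * z, ?_⟩,
    ⟨a * z - b * w + c * x + d * y, ?_⟩, ⟨a * w + b * z - c * y + d * x, ?_⟩⟩ <;>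
  simp [*]

lemma add_mem_Lip {α β : 𝔻} (hα : α ∈ Lip) (hβ : β ∈ Lip) : α + β ∈ Lip := by
  obtain ⟨⟨a, ha⟩, ⟨b, hb⟩, ⟨c, hc⟩, ⟨d, hd⟩⟩ := hα
  obtain ⟨⟨x, hx⟩, ⟨y, hy⟩, ⟨z, hz⟩, ⟨w, hw⟩⟩ := hβ
  exact ⟨⟨a + x, by simp [*]⟩, ⟨b + y, by simp [*]⟩, ⟨c + z, by simp [*]⟩, ⟨d + w, by simp [*]⟩⟩

lemma one_mem_Lip : (1 : 𝔻) ∈ Lip := ⟨⟨1, by simp⟩, ⟨0, by simp⟩, ⟨0, by simp⟩, ⟨0, by simp⟩⟩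

lemma qi_mem_Lip : qi ∈ Lip :=
  ⟨⟨0, by simp⟩, ⟨1, by simp⟩, ⟨0, by simp⟩, ⟨0, by simp⟩⟩

lemma qj_mem_Lip : qj ∈ Lip :=
  ⟨⟨0, by simp⟩, ⟨0, by simp⟩, ⟨1, by simp⟩, ⟨0, by simp⟩⟩

lemma qk_mem_Lip : qk ∈ Lip :=
  ⟨⟨0, by simp⟩, ⟨0, by simp⟩, ⟨0, by simp⟩, ⟨1, by simp⟩⟩

/-- A quarter of a Lipschitz quaternion `w` multiplies `4L ∪ (r + 4L)` into `L`
as soon as it sends `r` into `L`. -/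
lemma quarter_mul_mem_Lip {w r δ : 𝔻} (hw : w ∈ Lip) (hr : (4⁻¹ : ℚ) • w * r ∈ Lip)
    (hδ : δ ∈ scaleSet 4 Lip ∨ δ - r ∈ scaleSet 4 Lip) : (4⁻¹ : ℚ) • w * δ ∈ Lip := by
  have key : ∀ ε ∈ scaleSet 4 Lip, (4⁻¹ : ℚ) • w * ε ∈ Lip := by
    rintro _ ⟨β, hβ, rfl⟩
    convert mul_mem_Lip hw hβ using 1
    ext <;> simp [-Int.cast_ofNat] <;> ring
  rcases hδ with hδ | hδ
  · exact key δ hδ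
  · simpa [mul_sub] using add_mem_Lip (key _ hδ) hr

lemma mem_scaleSet_two {r δ : 𝔻} (hr : r ∈ scaleSet 2 Lip)
    (hδ : δ ∈ scaleSet 4 Lip ∨ δ - r ∈ scaleSet 4 Lip) : δ ∈ scaleSet 2 Lip := by
  obtain ⟨a, b, c, d, ha, hb, hc, hd⟩ := coords_of_mem_scaleSet hr
  push_cast at ha hb hc hd
  rcases hδ with hδ | hδ <;>
  obtain ⟨x, y, z, w, hx, hy, hz, hw⟩ := coords_of_mem_scaleSet hδ <;>
  push_cast at hx hy hz hw
  · refine scaleSet_mem_of_coords (2 * x) (2 * y) (2 * z) (2 * w) ?_ ?_ ?_ ?_ <;>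
      push_cast <;> linarith
  · simp only [Quaternion.re_sub, Quaternion.imI_sub, Quaternion.imJ_sub,
      Quaternion.imK_sub] at hx hy hz hw
    refine scaleSet_mem_of_coords (2 * x + a) (2 * y + b) (2 * z + c) (2 * w + d)
      ?_ ?_ ?_ ?_ <;> push_cast <;> linarith

lemma even_imaginary_of_commutators {w α : 𝔻} (hw : w = 1 + qi ∨ w = 1 + qj ∨ w = 1 + qk)
    (hi : (4⁻¹ : ℚ) • w * (qi * α - α * qi) ∈ Lip)
    (hj : (4⁻¹ : ℚ) • w * (qj * α - α * qj) ∈ Lip)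
    (hk : (4⁻¹ : ℚ) • w * (qk * α - α * qk) ∈ Lip) :
    isIntQ (α.imI / 2) ∧ isIntQ (α.imJ / 2) ∧ isIntQ (α.imK / 2) := by
  obtain ⟨-, ⟨a, ha⟩, ⟨b, hb⟩, ⟨c, hc⟩⟩ := hi
  obtain ⟨-, ⟨a', ha'⟩, ⟨b', hb'⟩, ⟨c', hc'⟩⟩ := hj
  obtain ⟨-, ⟨a'', ha''⟩, ⟨b'', hb''⟩, ⟨c'', hc''⟩⟩ := hk
  rcases hw with rfl | rfl | rfl <;>
  simp at ha hb hc ha' hb' hc' ha'' hb'' hc''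
  · exact ⟨⟨b'', by linarith⟩, ⟨-a'', by push_cast; linarith⟩, ⟨a', by linarith⟩⟩
  · exact ⟨⟨b'', by linarith⟩, ⟨c, by linarith⟩, ⟨-b, by push_cast; linarith⟩⟩
  · exact ⟨⟨-c', by push_cast; linarith⟩, ⟨c, by linarith⟩, ⟨a', by linarith⟩⟩

/-- If Δ(S) mod 4 is contained in a single set {0, r} with
r ∈ {2i+2j, 2i+2k, 2j+2k}, then S is not a ringset of L. -/
theorem stmt_18 (S : Set 𝔻) (hsub : S ⊂ Lip) (hred : IsReducedIn S Lip)
    (h : ∃ r ∈ ({2 * qi + 2 * qj, 2 * qi + 2 * qk, 2 * qj + 2 * qk} : Set 𝔻),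
      ∀ δ ∈ diffs S, δ ∈ scaleSet 4 Lip ∨ δ - r ∈ scaleSet 4 Lip) :
    ¬ IsRingset S Lip := by
  intro hS
  obtain ⟨r, hr, hΔ⟩ := h
  obtain ⟨α₀, hα₀⟩ := hred.nonempty
  have hdiff : ∀ α ∈ S, α - α₀ ∈ scaleSet 4 Lip ∨ α - α₀ - r ∈ scaleSet 4 Lip :=
    fun α hα => hΔ _ ⟨α, hα, α₀, hα₀, rfl⟩
  obtain ⟨w, hw, hwL, hwr, hr2⟩ : ∃ w : 𝔻, (w = 1 + qi ∨ w = 1 + qj ∨ w = 1 + qk) ∧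
      w ∈ Lip ∧ (4⁻¹ : ℚ) • w * r ∈ Lip ∧ r ∈ scaleSet 2 Lip := by
    rcases hr with rfl | rfl | rfl
    · refine ⟨1 + qk, by simp, add_mem_Lip one_mem_Lip qk_mem_Lip, ?_,
        qi + qj, add_mem_Lip qi_mem_Lip qj_mem_Lip, by simp [mul_add]⟩
      convert qj_mem_Lip using 1
      ext <;> simp [two_mul] <;> norm_num
    · refine ⟨1 + qj, by simp, add_mem_Lip one_mem_Lip qj_mem_Lip, ?_,
        qi + qk, add_mem_Lip qi_mem_Lip qk_mem_Lip, by simp [mul_add]⟩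
      convert qi_mem_Lip using 1
      ext <;> simp [two_mul] <;> norm_num
    · refine ⟨1 + qi, by simp, add_mem_Lip one_mem_Lip qi_mem_Lip, ?_,
        qj + qk, add_mem_Lip qj_mem_Lip qk_mem_Lip, by simp [mul_add]⟩
      convert qk_mem_Lip using 1
      ext <;> simp [two_mul] <;> norm_num
  have hcomm : ∀ u ∈ Lip, (4⁻¹ : ℚ) • w * (u * α₀ - α₀ * u) ∈ Lip := fun u hu =>
    hS.mul_commutator_mem hα₀ (fun α hα => quarter_mul_mem_Lip hwL hwr (hdiff α hα)) hu
  exact hred.not_even_imaginary (hsub.subset hα₀) (fun α hα => mem_scaleSet_two hr2 (hdiff α hα))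
    (even_imaginary_of_commutators hw (hcomm _ qi_mem_Lip) (hcomm _ qj_mem_Lip)
      (hcomm _ qk_mem_Lip))
end
end
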